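/- In R one has J((e^{ρ+β_1} + e^{ρ−2l·β_1})·∏_{i=2}^l (1 + e^{β_i})) = 0. -/

import Mathlib

open scoped BigOperators

noncomputable section

/-- The linear automorphism of `Fin l → ℚ` permuting the coordinates via `σ`. -/
def permEquiv (l : ℕ) (σ : Equiv.Perm (Fin l)) : (Fin l → ℚ) ≃ₗ[ℚ] (Fin l → ℚ) :=
  LinearEquiv.funCongrLeft ℚ ℚ σ

/-- The linear map changing the sign of the `i`-th coordinate. -/
def signChangeMap (l : ℕ) (i : Fin l) : (Fin l → ℚ) →ₗ[ℚ] (Fin l → ℚ) where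
  toFun v := fun j => if j = i then -v j else v j
  map_add' := by intro u v; funext j; by_cases h : j = i <;> simp [h] <;> ring
  map_smul' := by intro c v; funext j; by_cases h : j = i <;> simp [h] <;> ring

/-- The linear automorphism changing the sign of the `i`-th coordinate. -/
def signChange (l : ℕ) (i : Fin l) : (Fin l → ℚ) ≃ₗ[ℚ] (Fin l → ℚ) :=
  LinearEquiv.ofLinear (signChangeMap l i) (signChangeMap l i)
    (by apply LinearMap.ext; intro v; funext j;
        by_cases h : j = i <;> simp [signChangeMap, h])
    (by apply LinearMap.ext; intro v; funext j;
        by_cases h : j = i <;> simp [signChangeMap, h])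

/-- The group `W` of signed permutations of the coordinates, as a subgroup of
`GL(Fin l → ℚ)`: the subgroup generated by the coordinate permutations and the
sign changes of individual coordinates. -/
def signedPermGroup (l : ℕ) : Subgroup ((Fin l → ℚ) ≃ₗ[ℚ] (Fin l → ℚ)) :=
  Subgroup.closure (Set.range (permEquiv l) ∪ Set.range (signChange l))

/-- The Weyl vector `ρ = Σ_{i=1}^l (l − i + 1/2)·β_i` of `osp(1,2l)`;
in coordinates, `ρ_j = l − j − 1/2` for the `0`-indexed coordinate `j`. -/
def rho (l : ℕ) : Fin l → ℚ := fun j => (l : ℚ) - (j : ℚ) - 1/2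

/-- The standard basis vector `β_i` of `ℚ^l`, with `1`-indexed index `i`. -/
def betaN (l : ℕ) (i : ℕ) : Fin l → ℚ := fun j => if (j : ℕ) + 1 = i then 1 else 0

/-- The group algebra `R = MonoidAlgebra ℤ (Multiplicative (Fin l → ℚ))`. -/
abbrev Rg (l : ℕ) : Type := MonoidAlgebra ℤ (Multiplicative (Fin l → ℚ))

/-- The basis element `e^λ` of `R`. -/
def expw (l : ℕ) (lam : Fin l → ℚ) : Rg l :=
  MonoidAlgebra.of ℤ (Multiplicative (Fin l → ℚ)) (Multiplicative.ofAdd lam)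

/-- The sign of a signed permutation: its determinant, which is `±1`,
recorded as an integer. -/
def sgn (l : ℕ) (w : (Fin l → ℚ) ≃ₗ[ℚ] (Fin l → ℚ)) : ℤ :=
  if LinearMap.det w.toLinearMap = 1 then 1 else -1

/-- The action of a linear automorphism `w` of `Fin l → ℚ` on `R`,
sending `e^λ` to `e^{wλ}`. -/
def act (l : ℕ) (w : (Fin l → ℚ) ≃ₗ[ℚ] (Fin l → ℚ)) : Rg l ≃ₐ[ℤ] Rg l :=
  MonoidAlgebra.domCongr ℤ ℤ (AddEquiv.toMultiplicative w.toAddEquiv)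

/-- The ℤ-linear operator `J(a) = Σ_{w∈W} sgn(w)·(w·a)` on `R`. -/
def Jmap (l : ℕ) (a : Rg l) : Rg l :=
  ∑ᶠ w : signedPermGroup l, sgn l w.val • act l w.val a

/-- The `ℤ[[q]]`-linear operator `J(a) = Σ_{w∈W} sgn(w)·(w·a)` on `R[[q]]`,
where `W` acts coefficientwise. -/
def JQ (l : ℕ) (f : PowerSeries (Rg l)) : PowerSeries (Rg l) :=
  ∑ᶠ w : signedPermGroup l,
    sgn l w.val • PowerSeries.map ((act l w.val : Rg l ≃+* Rg l) : Rg l →+* Rg l) f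

theorem det_permEquiv_sq (l : ℕ) (σ : Equiv.Perm (Fin l)) :
    LinearMap.det (permEquiv l σ).toLinearMap ^ 2 = 1 := by
  have h : (permEquiv l σ).toLinearMap = Matrix.toLin' (σ.permMatrix ℚ) := by
    apply LinearMap.ext
    intro v
    rw [Matrix.toLin'_apply, Matrix.permMatrix_mulVec]
    rfl
  rw [h, LinearMap.det_toLin', Matrix.det_permutation]
  rcases Int.units_eq_one_or (Equiv.Perm.sign σ) with h | h <;> simp [h]

theorem det_signChange (l : ℕ) (i : Fin l) :
    LinearMap.det (signChange l i).toLinearMap = -1 := by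
  have h : (signChange l i).toLinearMap =
      Matrix.toLin' (Matrix.diagonal fun j => if j = i then (-1 : ℚ) else 1) := by
    apply LinearMap.ext
    intro v
    funext j
    rw [Matrix.toLin'_apply, Matrix.mulVec_diagonal]
    by_cases hj : j = i <;> simp [signChange, signChangeMap, hj]
  rw [h, LinearMap.det_toLin', Matrix.det_diagonal]
  simp

theorem det_sq_of_mem_signedPermGroup (l : ℕ) (w : (Fin l → ℚ) ≃ₗ[ℚ] (Fin l → ℚ))
    (hw : w ∈ signedPermGroup l) : LinearMap.det w.toLinearMap ^ 2 = 1 := by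
  have hle : signedPermGroup l ≤ ((powMonoidHom 2).comp LinearEquiv.det).ker := by
    refine (Subgroup.closure_le _).2 ?_
    rintro _ (⟨σ, rfl⟩ | ⟨i, rfl⟩)
    · refine MonoidHom.mem_ker.2 (Units.ext ?_)
      simpa using det_permEquiv_sq l σ
    · refine MonoidHom.mem_ker.2 (Units.ext ?_)
      simp [det_signChange]
  simpa using congrArg Units.val (MonoidHom.mem_ker.1 (hle hw))

theorem sgn_mul_signChange (l : ℕ) (i : Fin l) (w : (Fin l → ℚ) ≃ₗ[ℚ] (Fin l → ℚ))
    (hw : w ∈ signedPermGroup l) : sgn l (w * signChange l i) = -sgn l w := by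
  have h : LinearMap.det (w * signChange l i).toLinearMap =
      -LinearMap.det w.toLinearMap := by
    have := LinearMap.det_comp w.toLinearMap (signChange l i).toLinearMap
    rw [det_signChange, mul_neg_one] at this
    exact this
  unfold sgn
  rw [h]
  rcases mul_self_eq_one_iff.1 ((sq _).symm.trans (det_sq_of_mem_signedPermGroup l w hw)) with h1 | h1 <;>
    rw [h1] <;> norm_num

theorem act_expw (l : ℕ) (w : (Fin l → ℚ) ≃ₗ[ℚ] (Fin l → ℚ)) (v : Fin l → ℚ) :
    act l w (expw l v) = expw l (w v) := by
  simp [act, expw]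

theorem act_mul_apply (l : ℕ) (w s : (Fin l → ℚ) ≃ₗ[ℚ] (Fin l → ℚ)) (a : Rg l) :
    act l (w * s) a = act l w (act l s a) := by
  have h : (act l (w * s)).toAlgHom = (act l w).toAlgHom.comp (act l s).toAlgHom := by
    ext v
    simp [act]
  exact DFunLike.congr_fun h a

/-- `J` annihilates every element fixed by a sign change. -/
theorem Jmap_eq_zero_of_act_signChange_eq (l : ℕ) (i : Fin l) (a : Rg l)
    (ha : act l (signChange l i) a = a) : Jmap l a = 0 := by
  have hs : signChange l i ∈ signedPermGroup l :=
    Subgroup.subset_closure (Or.inr ⟨i, rfl⟩)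
  have h : Jmap l a = -Jmap l a := by
    unfold Jmap
    conv_lhs => rw [← finsum_comp_equiv (Equiv.mulRight (⟨_, hs⟩ : signedPermGroup l))]
    rw [← finsum_neg_distrib]
    refine finsum_congr fun w => ?_
    rw [Equiv.coe_mulRight, Subgroup.coe_mul, sgn_mul_signChange l i _ w.2, act_mul_apply, ha,
      neg_smul]
  ext m
  have hm := congrArg (fun f : Rg l => f.coeff m) h
  simp only [MonoidAlgebra.coeff_neg, Finsupp.neg_apply] at hm
  rw [MonoidAlgebra.coeff_zero, Finsupp.zero_apply]
  omega

/-- In `R` one has `J((e^{ρ+β_1} + e^{ρ−2l·β_1})·∏_{i=2}^l (1 + e^{β_i})) = 0`. -/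
theorem stmt_6 (l : ℕ) (hl : 1 ≤ l) :
    Jmap l ((expw l (rho l + betaN l 1) + expw l (rho l - (2 * (l : ℚ)) • betaN l 1)) *
      ∏ i ∈ Finset.Icc 2 l, (1 + expw l (betaN l i))) = 0 := by
  have hval (j : Fin l) : j = ⟨0, hl⟩ ↔ (j : ℕ) = 0 := Fin.ext_iff
  have h1 : signChange l ⟨0, hl⟩ (rho l + betaN l 1) =
      rho l - (2 * (l : ℚ)) • betaN l 1 := by
    funext j
    by_cases hj : (j : ℕ) = 0 <;>
      simp [signChange, signChangeMap, rho, betaN, hval, hj]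
    ring
  have h2 : signChange l ⟨0, hl⟩ (rho l - (2 * (l : ℚ)) • betaN l 1) =
      rho l + betaN l 1 := by
    funext j
    by_cases hj : (j : ℕ) = 0 <;>
      simp [signChange, signChangeMap, rho, betaN, hval, hj]
    ring
  have h3 (i : ℕ) (hi : i ∈ Finset.Icc 2 l) :
      signChange l ⟨0, hl⟩ (betaN l i) = betaN l i := by
    have hi' : 1 ≠ i := by have := (Finset.mem_Icc.1 hi).1; omega
    funext j
    by_cases hj : (j : ℕ) = 0 <;>
      simp [signChange, signChangeMap, betaN, hval, hj, hi']
  apply Jmap_eq_zero_of_act_signChange_eq l ⟨0, hl⟩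
  rw [map_mul, map_add, act_expw, act_expw, h1, h2, map_prod, add_comm]
  congr 1
  refine Finset.prod_congr rfl fun i hi => ?_
  rw [map_add, map_one, act_expw, h3 i hi]
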